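/- The product ⋆₁ (the Grossman–Larson product) on ℚRT(S) is associative: (a ⋆₁ b) ⋆₁ c = a ⋆₁ (b ⋆₁ c) for all a, b, c ∈ ℚRT(S). -/

import Mathlib

/-! S-labelled planar rooted trees: a tree is a root together with a finite ordered
list of branches, a branch being a label in `S` together with a subtree. -/

mutual
/-- An `S`-labelled planar rooted tree: an unlabelled root with an ordered list of branches. -/
inductive PTree (S : Type) : Type
  | node : Branches S → PTree S

/-- An ordered list of branches; each branch is a label in `S` together with a subtree. -/
inductive Branches (S : Type) : Type
  | nil : Branches S
  | cons : S → PTree S → Branches S → Branches S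
end

variable {S : Type}

/-- Concatenation of branch lists. -/
def Branches.append : Branches S → Branches S → Branches S
  | .nil, c => c
  | .cons s t rest, c => .cons s t (Branches.append rest c)

/-- The number of branches in a list. -/
def Branches.len : Branches S → ℕ
  | .nil => 0
  | .cons _ _ rest => Branches.len rest + 1

mutual
/-- The list of arities (numbers of children) of the vertices of a tree,
in preorder (root first, then the subtrees from left to right). -/
def PTree.arities : PTree S → List ℕ
  | .node b => Branches.len b :: Branches.arities b

/-- The concatenated preorder arity lists of the subtrees of a branch list. -/
def Branches.arities : Branches S → List ℕ
  | .nil => []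
  | .cons _ t rest => PTree.arities t ++ Branches.arities rest
end

/-- The number of vertices of a tree (including the root). -/
def PTree.nv (T : PTree S) : ℕ := T.arities.length

/-- The degree of a tree: its number of non-root vertices. -/
def PTree.deg (T : PTree S) : ℕ := T.nv - 1

/-- The number of children of the root. -/
def PTree.rootArity : PTree S → ℕ
  | .node b => Branches.len b

/-- The list of branches at the root. -/
def PTree.branches : PTree S → Branches S
  | .node b => b

mutual
/-- Graft, for every vertex `v` of the tree (indexed in preorder), the branch list `φ v`
at `v`, placing the grafted branches to the left of the existing children of `v`. -/
def PTree.graft : PTree S → (ℕ → Branches S) → PTree S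
  | .node b, φ => .node (Branches.append (φ 0) (Branches.graftB b (fun n => φ (n + 1))))

/-- Graft branch lists into all subtrees of a branch list, the vertex indices being
distributed in preorder. -/
def Branches.graftB : Branches S → (ℕ → Branches S) → Branches S
  | .nil, _ => .nil
  | .cons s t rest, φ =>
      .cons s (PTree.graft t φ)
        (Branches.graftB rest (fun n => φ (n + (PTree.arities t).length)))
end

/-- The sublist of a branch list consisting of the branches whose position (counted from 0)
satisfies the predicate, in their original order. -/
def Branches.filterIdx : Branches S → (ℕ → Bool) → Branches S
  | .nil, _ => .nil
  | .cons s t rest, p =>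
      if p 0 then .cons s t (Branches.filterIdx rest (fun n => p (n + 1)))
      else Branches.filterIdx rest (fun n => p (n + 1))

/-- The tree `T₁ ∘^f T₂` for a function `f` from the root-branches of `T₁` to the
(preorder-indexed) vertices of `T₂`: graft, at each vertex `v` of `T₂`, the branches of
`T₁` lying over `v`, in order, to the left of the existing children of `v`. -/
def graftAlong (T₁ T₂ : PTree S) (f : Fin T₁.rootArity → Fin T₂.nv) : PTree S :=
  T₂.graft fun v => T₁.branches.filterIdx fun i =>
    if h : i < T₁.rootArity then decide ((f ⟨i, h⟩ : ℕ) = v) else false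

/-- The product `T₁ ⋆₁ T₂` of two trees: the sum of `T₁ ∘^f T₂` over all functions `f`
from the root-branches of `T₁` to the vertices of `T₂`. -/
noncomputable def treeProd1 (T₁ T₂ : PTree S) : PTree S →₀ ℚ :=
  ∑ f : Fin T₁.rootArity → Fin T₂.nv, Finsupp.single (graftAlong T₁ T₂ f) 1

/-- Vertex number `v` (in preorder) of `T` is internal, i.e. has at least one child. -/
def PTree.isInternal (T : PTree S) (v : ℕ) : Prop := T.arities.getD v 0 ≠ 0

open Classical in
/-- The product `T₁ ⋆₂ T₂` of two trees: the sum of `T₁ ∘^g T₂` over all functions `g`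
from the root-branches of `T₁` to the internal vertices of `T₂`. -/
noncomputable def treeProd2 (T₁ T₂ : PTree S) : PTree S →₀ ℚ :=
  ∑ f : Fin T₁.rootArity → Fin T₂.nv,
    if ∀ i, T₂.isInternal (f i) then Finsupp.single (graftAlong T₁ T₂ f) 1 else 0

/-- The bilinear extension to `ℚRT(S)` of a product of trees with values in `ℚRT(S)`. -/
noncomputable def starLin (P : PTree S → PTree S → (PTree S →₀ ℚ)) :
    (PTree S →₀ ℚ) →ₗ[ℚ] (PTree S →₀ ℚ) →ₗ[ℚ] (PTree S →₀ ℚ) :=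
  Finsupp.lsum ℚ fun T₁ =>
    LinearMap.toSpanSingleton ℚ _
      (Finsupp.lsum ℚ fun T₂ => LinearMap.toSpanSingleton ℚ _ (P T₁ T₂))

/-- The first product `⋆₁` (the Grossman–Larson product) on `ℚRT(S)`. -/
noncomputable def star1 (x y : PTree S →₀ ℚ) : PTree S →₀ ℚ := starLin treeProd1 x y

/-- The second product `⋆₂` on `ℚRT(S)`. -/
noncomputable def star2 (x y : PTree S →₀ ℚ) : PTree S →₀ ℚ := starLin treeProd2 x y


namespace Branches

theorem append_nil (A : Branches S) : A.append .nil = A := by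
  induction A using Branches.rec (motive_1 := fun _ => True) with
  | node => trivial
  | nil => rfl
  | cons s t B _ ih => rw [append, ih]

theorem append_assoc (A B C : Branches S) :
    (A.append B).append C = A.append (B.append C) := by
  induction A using Branches.rec (motive_1 := fun _ => True) with
  | node => trivial
  | nil => rfl
  | cons s t A _ ih => simp only [append, ih]

/-- The unshuffle coproduct: all ways to split a branch list into two complementary sublists. -/
def coprod : Branches S → Multiset (Branches S × Branches S)
  | .nil => {(.nil, .nil)}
  | .cons s t B =>
      (coprod B).bind fun p => {(.cons s t p.1, p.2)} + {(p.1, .cons s t p.2)}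

theorem coprod_nil_bind {X : Type*} (F : Branches S × Branches S → Multiset X) :
    (coprod (.nil : Branches S)).bind F = F (.nil, .nil) := by
  rw [coprod, Multiset.singleton_bind]

theorem coprod_cons_bind {X : Type*} (s : S) (t : PTree S) (B : Branches S)
    (F : Branches S × Branches S → Multiset X) :
    (coprod (.cons s t B)).bind F =
      (coprod B).bind fun p => F (.cons s t p.1, p.2) + F (p.1, .cons s t p.2) := by
  simp only [coprod, Multiset.bind_assoc, Multiset.add_bind, Multiset.singleton_bind]

theorem coprod_comm {X : Type*} (A : Branches S) (F : Branches S → Branches S → Multiset X) :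
    ((coprod A).bind fun p => F p.1 p.2) = (coprod A).bind fun p => F p.2 p.1 := by
  induction A using Branches.rec (motive_1 := fun _ => True) generalizing F with
  | node => trivial
  | nil => simp only [coprod_nil_bind]
  | cons s t A _ ih =>
    simp only [coprod_cons_bind, Multiset.bind_add]
    rw [ih fun x y => F (.cons s t x) y, ih fun x y => F x (.cons s t y), add_comm]

theorem coprod_coassoc {X : Type*} (A : Branches S)
    (F : Branches S → Branches S → Branches S → Multiset X) :
    ((coprod A).bind fun p => (coprod p.1).bind fun q => F q.1 q.2 p.2) =
      (coprod A).bind fun p => (coprod p.2).bind fun q => F p.1 q.1 q.2 := by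
  induction A using Branches.rec (motive_1 := fun _ => True) generalizing F with
  | node => trivial
  | nil => simp only [coprod_nil_bind]
  | cons s t A _ ih =>
    simp only [coprod_cons_bind, Multiset.bind_add]
    rw [ih fun x y z => F (.cons s t x) y z, ih fun x y z => F x (.cons s t y) z,
      ih fun x y z => F x y (.cons s t z), add_assoc]

theorem coprod_swap {X : Type*} (A : Branches S)
    (F : Branches S → Branches S → Branches S → Multiset X) :
    ((coprod A).bind fun p => (coprod p.2).bind fun q => F p.1 q.1 q.2) =
      (coprod A).bind fun p => (coprod p.2).bind fun q => F q.1 p.1 q.2 := by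
  rw [← coprod_coassoc, ← coprod_coassoc A fun x y z => F y x z]
  exact Multiset.bind_congr fun p _ => coprod_comm p.1 fun x y => F x y p.2

/-- Exchange of the two middle factors of the iterated coproduct. -/
theorem coprod_exchange {X : Type*} (A : Branches S)
    (F : Branches S → Branches S → Branches S → Branches S → Multiset X) :
    ((coprod A).bind fun p => (coprod p.1).bind fun q => (coprod p.2).bind fun r =>
        F q.1 q.2 r.1 r.2) =
      (coprod A).bind fun p => (coprod p.1).bind fun q => (coprod p.2).bind fun r =>
        F q.1 r.1 q.2 r.2 := by
  induction A using Branches.rec (motive_1 := fun _ => True) generalizing F with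
  | node => trivial
  | nil => simp only [coprod_nil_bind]
  | cons s t A _ ih =>
    simp only [coprod_cons_bind, Multiset.bind_add]
    rw [ih fun x y z w => F (.cons s t x) y z w, ih fun x y z w => F x (.cons s t y) z w,
      ih fun x y z w => F x y (.cons s t z) w, ih fun x y z w => F x y z (.cons s t w)]
    abel

theorem coprod_append {X : Type*} (A B : Branches S)
    (F : Branches S → Branches S → Multiset X) :
    ((coprod (A.append B)).bind fun p => F p.1 p.2) =
      (coprod A).bind fun p => (coprod B).bind fun q => F (p.1.append q.1) (p.2.append q.2) := by
  induction A using Branches.rec (motive_1 := fun _ => True) generalizing F with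
  | node => trivial
  | nil => simp only [coprod_nil_bind, append]
  | cons s t A _ ih =>
    simp only [coprod_cons_bind, append, Multiset.bind_add]
    rw [ih fun x y => F (.cons s t x) y, ih fun x y => F x (.cons s t y)]

/-- The counit: one copy of the empty list on the empty list, and nothing otherwise. -/
def counit : Branches S → Multiset (Branches S)
  | .nil => {.nil}
  | .cons _ _ _ => 0

theorem counit_nil : counit (.nil : Branches S) = {.nil} := rfl

theorem counit_cons (s : S) (t : PTree S) (B : Branches S) : counit (.cons s t B) = 0 := rfl

theorem coprod_counit_left {X : Type*} (A : Branches S)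
    (F : Branches S → Branches S → Multiset X) :
    ((coprod A).bind fun p => (counit p.1).bind fun b => F b p.2) = F .nil A := by
  induction A using Branches.rec (motive_1 := fun _ => True) generalizing F with
  | node => trivial
  | nil => simp only [coprod_nil_bind, counit, Multiset.singleton_bind]
  | cons s t A _ ih =>
    simp only [coprod_cons_bind, counit, Multiset.zero_bind, zero_add]
    exact ih fun x y => F x (.cons s t y)

theorem coprod_counit_counit {X : Type*} (A : Branches S)
    (F : Branches S → Branches S → Multiset X) :
    ((coprod A).bind fun p => (counit p.1).bind fun b => (counit p.2).bind fun c => F b c) =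
      (counit A).bind fun a => F a a := by
  rw [coprod_counit_left A fun b y => (counit y).bind fun c => F b c]
  cases A <;> simp [counit]

end Branches

mutual
/-- All ways to graft a branch list at the vertices of a tree. -/
def PTree.grafts : PTree S → Branches S → Multiset (PTree S)
  | .node B, A => (Branches.coprod A).bind fun p =>
      (Branches.grafts B p.2).bind fun b => {.node (p.1.append b)}

/-- All ways to graft the second branch list at the non-root vertices of the first one. -/
def Branches.grafts : Branches S → Branches S → Multiset (Branches S)
  | .nil, A => Branches.counit A
  | .cons s t B, A => (Branches.coprod A).bind fun p =>
      (PTree.grafts t p.1).bind fun u => (Branches.grafts B p.2).bind fun b => {.cons s u b}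
end

namespace Branches

/-- The Grossman-Larson product of branch lists: all ways to graft the first argument at the
vertices of the tree whose root-branches are the second one. -/
def glProd (A B : Branches S) : Multiset (Branches S) :=
  (coprod A).bind fun p => (B.grafts p.2).bind fun b => {p.1.append b}

theorem glProd_bind {X : Type*} (A B : Branches S) (F : Branches S → Multiset X) :
    (glProd A B).bind F =
      (coprod A).bind fun p => (B.grafts p.2).bind fun b => F (p.1.append b) := by
  simp only [glProd, Multiset.bind_assoc, Multiset.singleton_bind]

theorem node_grafts (A B : Branches S) :
    (PTree.node B).grafts A = (glProd A B).bind fun b => {.node b} := by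
  simp only [PTree.grafts, glProd_bind]

theorem grafts_cons_bind {X : Type*} (A : Branches S) (s : S) (t : PTree S) (B : Branches S)
    (F : Branches S → Multiset X) :
    ((Branches.cons s t B).grafts A).bind F = (coprod A).bind fun p =>
      (t.grafts p.1).bind fun u => (B.grafts p.2).bind fun b => F (.cons s u b) := by
  simp only [grafts, Multiset.bind_assoc, Multiset.singleton_bind]

theorem nil_grafts : (.nil : Branches S).grafts = counit := rfl

theorem grafts_append_bind {X : Type*} (A B C : Branches S) (F : Branches S → Multiset X) :
    ((B.append C).grafts A).bind F = (coprod A).bind fun p =>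
      (B.grafts p.1).bind fun b => (C.grafts p.2).bind fun c => F (b.append c) := by
  induction B using Branches.rec (motive_1 := fun _ => True) generalizing A F with
  | node => trivial
  | nil =>
    simp only [grafts, append]
    rw [coprod_counit_left A fun b y => (C.grafts y).bind fun c => F (b.append c)]
    rfl
  | cons s t B _ ih =>
    simp only [grafts_cons_bind, append, ih]
    rw [coprod_coassoc A fun x y z => (t.grafts x).bind fun u => (B.grafts y).bind fun b =>
      (C.grafts z).bind fun c => F (.cons s u (b.append c))]
    refine Multiset.bind_congr fun p _ => ?_
    rw [Multiset.bind_bind]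

/-- Grafting is compatible with the coproducts. -/
theorem coprod_grafts {X : Type*} (A B : Branches S) (F : Branches S → Branches S → Multiset X) :
    ((B.grafts A).bind fun b => (coprod b).bind fun p => F p.1 p.2) =
      (coprod A).bind fun p => (coprod B).bind fun q =>
        (q.1.grafts p.1).bind fun b => (q.2.grafts p.2).bind fun c => F b c := by
  induction B using Branches.rec (motive_1 := fun _ => True) generalizing A F with
  | node => trivial
  | nil =>
    simp only [grafts, coprod_nil_bind]
    rw [coprod_counit_counit]
    cases A <;> simp [counit, coprod]
  | cons s t B _ ih =>
    simp only [grafts_cons_bind, coprod_cons_bind, Multiset.bind_add]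
    congr 1
    · have h := fun (u : PTree S) (y : Branches S) => ih y fun b c => F (.cons s u b) c
      simp only [h]
      refine (Multiset.bind_congr fun p _ => Multiset.bind_bind _ _).trans ?_
      rw [← coprod_coassoc A fun x y z => (t.grafts x).bind fun u => (coprod B).bind fun q =>
        (q.1.grafts y).bind fun b => (q.2.grafts z).bind fun c => F (.cons s u b) c]
      simp only [Multiset.bind_bind _ (coprod B)]
    · have h := fun (u : PTree S) (y : Branches S) => ih y fun b c => F b (.cons s u c)
      simp only [h]
      refine (Multiset.bind_congr fun p _ => Multiset.bind_bind _ _).trans ?_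
      rw [coprod_swap A fun x y z => (t.grafts x).bind fun u => (coprod B).bind fun q =>
        (q.1.grafts y).bind fun b => (q.2.grafts z).bind fun c => F b (.cons s u c)]
      simp only [Multiset.bind_bind _ (coprod B)]
      refine Multiset.bind_congr fun q _ => Multiset.bind_congr fun p _ => ?_
      rw [Multiset.bind_bind (q.1.grafts _)]
      exact Multiset.bind_congr fun r _ => Multiset.bind_bind _ _

theorem coprod_glProd {X : Type*} (A B : Branches S)
    (F : Branches S → Branches S → Multiset X) :
    ((glProd A B).bind fun b => (coprod b).bind fun p => F p.1 p.2) =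
      (coprod A).bind fun p => (coprod B).bind fun q =>
        (glProd p.1 q.1).bind fun b => (glProd p.2 q.2).bind fun c => F b c := by
  simp only [glProd_bind, coprod_append]
  have h := fun (x y z : Branches S) => coprod_grafts x B fun b c => F (y.append b) (z.append c)
  simp only [Multiset.bind_bind (B.grafts _), h]
  rw [coprod_exchange A fun x y z w => (coprod B).bind fun q => (q.1.grafts z).bind fun b =>
    (q.2.grafts w).bind fun c => F (x.append b) (y.append c)]
  refine Multiset.bind_congr fun p _ => ?_
  simp only [Multiset.bind_bind _ (coprod B)]
  refine Multiset.bind_congr fun q _ => Multiset.bind_congr fun r _ => ?_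
  rw [Multiset.bind_bind]

/-- If grafting onto `C` is an action of the Grossman-Larson product, then that product is
associative when its right argument is `C`. -/
theorem glProd_assoc_of_grafts (C : Branches S)
    (h : ∀ A B, (glProd A B).bind C.grafts = (C.grafts B).bind fun c => c.grafts A)
    (A B : Branches S) :
    ((glProd A B).bind fun x => glProd x C) = (glProd B C).bind fun y => glProd A y := by
  have h₁ := fun (a b x : Branches S) =>
    congrArg (fun m => m.bind fun c => ({x.append c} : Multiset (Branches S))) (h a b)
  simp only [Multiset.bind_assoc] at h₁
  simp only [glProd]
  rw [← glProd, coprod_glProd A B fun x y => (C.grafts y).bind fun c => {x.append c}]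
  simp only [h₁, glProd_bind, grafts_append_bind, append_assoc, Multiset.bind_assoc,
    Multiset.singleton_bind]
  refine (Multiset.bind_congr fun p _ => Multiset.bind_bind _ _).trans ?_
  rw [coprod_coassoc A fun x y z => (coprod B).bind fun q => (q.1.grafts y).bind fun b =>
    (C.grafts q.2).bind fun c => (c.grafts z).bind fun d => {x.append (b.append d)}]
  simp only [Multiset.bind_bind _ (coprod A)]
  simp only [Multiset.bind_bind _ (coprod B)]
  refine Multiset.bind_congr fun b _ => Multiset.bind_congr fun a _ => ?_
  rw [Multiset.bind_bind (C.grafts _)]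
  refine Multiset.bind_congr fun p _ => ?_
  rw [Multiset.bind_bind]

theorem grafts_grafts (C : Branches S) : ∀ A B : Branches S,
    (glProd A B).bind C.grafts = (C.grafts B).bind fun c => c.grafts A := by
  induction C using Branches.rec (motive_1 := fun t => ∀ A B,
    (glProd A B).bind t.grafts = (t.grafts B).bind fun c => c.grafts A) with
  | node C ih =>
    rename_i A B
    have h := congrArg (fun m => m.bind fun c => ({.node c} : Multiset (PTree S)))
      (glProd_assoc_of_grafts C ih A B)
    simp only [Multiset.bind_assoc] at h
    simp only [node_grafts, Multiset.bind_assoc, Multiset.singleton_bind]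
    exact h
  | nil =>
    intro A B
    simp only [nil_grafts]
    cases B with
    | nil =>
      simp only [glProd_bind, nil_grafts, counit_nil, Multiset.singleton_bind]
      rw [coprod_comm A fun x y => (counit y).bind fun b => counit (x.append b),
        coprod_counit_left A fun b y => counit (y.append b), append_nil]
    | cons s t B =>
      have e : ∀ (a : Branches S) (u : PTree S) (b : Branches S),
          counit (a.append (.cons s u b)) = 0 := fun a u b => by cases a <;> rfl
      simp only [glProd_bind, grafts_cons_bind, e, counit_cons, Multiset.zero_bind,
        Multiset.bind_zero]
  | cons s t C iht ih =>
    intro A B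
    have e : ∀ (A : Branches S) (t : PTree S) (B : Branches S),
        (cons s t B).grafts A = (coprod A).bind fun p => (t.grafts p.1).bind fun u =>
          (B.grafts p.2).bind fun b => {.cons s u b} := fun A t B => rfl
    have ht := fun (a b : Branches S) (F : PTree S → Multiset (Branches S)) =>
      congrArg (fun m => m.bind F) (iht a b)
    have hC := fun (a b : Branches S) (F : Branches S → Multiset (Branches S)) =>
      congrArg (fun m => m.bind F) (ih a b)
    simp only [Multiset.bind_assoc] at ht hC
    simp only [e, Multiset.bind_assoc, Multiset.singleton_bind]
    refine (coprod_glProd A B fun x y => (t.grafts x).bind fun u => (C.grafts y).bind fun c =>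
      {cons s u c}).trans ?_
    simp only [Multiset.bind_bind (glProd _ _) (t.grafts _), hC, ht]
    simp only [Multiset.bind_bind _ (coprod A)]
    refine Multiset.bind_congr fun a _ => Multiset.bind_congr fun b _ =>
      Multiset.bind_congr fun u _ => ?_
    rw [Multiset.bind_bind]

theorem glProd_assoc (A B C : Branches S) :
    ((glProd A B).bind fun x => glProd x C) = (glProd B C).bind fun y => glProd A y :=
  glProd_assoc_of_grafts C (fun A B => grafts_grafts C A B) A B

end Branches

namespace Branches

/-- All ways to distribute the branches of a list over the vertices `0, …, n - 1`, each recorded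
as the function sending a vertex to the sublist of branches lying over it. -/
def assigns : Branches S → ℕ → Multiset (ℕ → Branches S)
  | .nil, _ => {fun _ => .nil}
  | .cons s t B, n => (assigns B n).bind fun φ =>
      (Multiset.range n).bind fun v => {Function.update φ v (.cons s t (φ v))}

theorem assigns_nil_bind {X : Type*} (n : ℕ) (F : (ℕ → Branches S) → Multiset X) :
    (assigns .nil n).bind F = F fun _ => .nil := by
  rw [assigns, Multiset.singleton_bind]

theorem assigns_cons_bind {X : Type*} (s : S) (t : PTree S) (B : Branches S) (n : ℕ)
    (F : (ℕ → Branches S) → Multiset X) :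
    (assigns (.cons s t B) n).bind F = (assigns B n).bind fun φ =>
      (Multiset.range n).bind fun v => F (Function.update φ v (.cons s t (φ v))) := by
  simp only [assigns, Multiset.bind_assoc, Multiset.singleton_bind]

theorem assigns_zero_bind {X : Type*} (A : Branches S) (F : (ℕ → Branches S) → Multiset X) :
    (assigns A 0).bind F = (counit A).bind fun _ => F fun _ => .nil := by
  cases A with
  | nil => simp only [assigns_nil_bind, counit, Multiset.singleton_bind]
  | cons s t A =>
    simp only [assigns_cons_bind, counit, Multiset.range_zero, Multiset.zero_bind,
      Multiset.bind_zero]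

theorem assigns_one_bind {X : Type*} (A : Branches S) (F : (ℕ → Branches S) → Multiset X) :
    (assigns A 1).bind F = F (Function.update (fun _ => .nil) 0 A) := by
  induction A using Branches.rec (motive_1 := fun _ => True) generalizing F with
  | node => trivial
  | nil => rw [assigns_nil_bind, Function.update_eq_self_iff.2 rfl]
  | cons s t A _ ih =>
    have h : Multiset.range 1 = {0} := rfl
    rw [assigns_cons_bind, ih, h, Multiset.singleton_bind, Function.update_idem,
      Function.update_self]

/-- The function equal to `φ` on `0, …, n - 1` and to the translate of `ψ` from `n` on. -/
def merge (n : ℕ) (φ ψ : ℕ → Branches S) : ℕ → Branches S :=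
  fun v => if v < n then φ v else ψ (v - n)

theorem merge_of_lt {n v : ℕ} (φ ψ : ℕ → Branches S) (h : v < n) : merge n φ ψ v = φ v :=
  if_pos h

theorem merge_add (n v : ℕ) (φ ψ : ℕ → Branches S) : merge n φ ψ (n + v) = ψ v := by
  simp [merge]

theorem update_merge_of_lt {n v : ℕ} (φ ψ : ℕ → Branches S) (b : Branches S) (h : v < n) :
    Function.update (merge n φ ψ) v b = merge n (Function.update φ v b) ψ := by
  funext w
  simp only [merge, Function.update_apply]
  grind

theorem update_merge_add (n v : ℕ) (φ ψ : ℕ → Branches S) (b : Branches S) :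
    Function.update (merge n φ ψ) (n + v) b = merge n φ (Function.update ψ v b) := by
  funext w
  simp only [merge, Function.update_apply]
  grind

theorem assigns_add_bind {X : Type*} (A : Branches S) (n m : ℕ)
    (F : (ℕ → Branches S) → Multiset X) :
    (assigns A (n + m)).bind F = (coprod A).bind fun p =>
      (assigns p.1 n).bind fun φ => (assigns p.2 m).bind fun ψ => F (merge n φ ψ) := by
  induction A using Branches.rec (motive_1 := fun _ => True) generalizing F with
  | node => trivial
  | nil =>
    simp only [assigns_nil_bind, coprod_nil_bind]
    exact congrArg F (funext fun v => by simp [merge])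
  | cons s t A _ ih =>
    simp only [assigns_cons_bind, coprod_cons_bind, ih]
    refine Multiset.bind_congr fun p _ => ?_
    rw [Multiset.range_add]
    simp only [Multiset.add_bind, Multiset.bind_add, Multiset.bind_map]
    congr 1
    · refine Multiset.bind_congr fun φ _ => ?_
      rw [Multiset.bind_bind]
      refine Multiset.bind_congr fun v hv => Multiset.bind_congr fun ψ _ => ?_
      rw [Multiset.mem_range] at hv
      rw [update_merge_of_lt _ _ _ hv, merge_of_lt _ _ hv]
    · refine Multiset.bind_congr fun φ _ => Multiset.bind_congr fun ψ _ =>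
        Multiset.bind_congr fun v _ => ?_
      rw [update_merge_add, merge_add]

end Branches

mutual
theorem PTree.graft_congr (t : PTree S) (φ ψ : ℕ → Branches S)
    (h : ∀ v < t.arities.length, φ v = ψ v) : t.graft φ = t.graft ψ := by
  cases t with
  | node B =>
    simp only [PTree.arities, List.length_cons] at h
    rw [PTree.graft, PTree.graft, h 0 (by omega),
      Branches.graftB_congr B _ _ fun v hv => h (v + 1) (by omega)]

theorem Branches.graftB_congr (B : Branches S) (φ ψ : ℕ → Branches S)
    (h : ∀ v < B.arities.length, φ v = ψ v) : B.graftB φ = B.graftB ψ := by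
  cases B with
  | nil => rfl
  | cons s t B =>
    simp only [Branches.arities, List.length_append] at h
    rw [Branches.graftB, Branches.graftB, PTree.graft_congr t _ _ fun v hv => h v (by omega),
      Branches.graftB_congr B _ _ fun v hv => h _ (by omega)]
end

mutual
theorem PTree.grafts_bind {X : Type*} (t : PTree S) (A : Branches S) (F : PTree S → Multiset X) :
    (t.grafts A).bind F = (A.assigns t.arities.length).bind fun φ => F (t.graft φ) := by
  cases t with
  | node B =>
    simp only [PTree.arities, List.length_cons, PTree.grafts, Multiset.bind_assoc,
      Multiset.singleton_bind, PTree.graft]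
    rw [add_comm, Branches.assigns_add_bind]
    refine Multiset.bind_congr fun p _ => ?_
    rw [Branches.assigns_one_bind, Branches.grafts_bind]
    refine Multiset.bind_congr fun ψ _ => ?_
    rw [Branches.merge_of_lt _ _ one_pos, Function.update_self]
    simp only [add_comm _ 1, Branches.merge_add]

theorem Branches.grafts_bind {X : Type*} (B : Branches S) (A : Branches S)
    (F : Branches S → Multiset X) :
    (B.grafts A).bind F = (A.assigns B.arities.length).bind fun φ => F (B.graftB φ) := by
  cases B with
  | nil =>
    simp only [Branches.arities, List.length_nil, Branches.assigns_zero_bind,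
      Branches.nil_grafts, Branches.graftB]
    cases A <;> rfl
  | cons s t B =>
    rw [Branches.grafts_cons_bind, Branches.arities, List.length_append,
      Branches.assigns_add_bind]
    refine Multiset.bind_congr fun p _ => ?_
    rw [PTree.grafts_bind t]
    refine Multiset.bind_congr fun φ _ => ?_
    rw [Branches.grafts_bind B]
    refine Multiset.bind_congr fun ψ _ => ?_
    rw [Branches.graftB, PTree.graft_congr t _ φ fun v hv => Branches.merge_of_lt _ _ hv]
    simp only [add_comm _ t.arities.length, Branches.merge_add]
end

/-- Summing over all functions from the branches of `B` to `n` vertices amounts to summing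
over the corresponding distributions of branches. -/
theorem Branches.sum_filterIdx {M : Type*} [AddCommMonoid M] (B : Branches S) (n : ℕ)
    (G : (ℕ → Branches S) → M) :
    ∑ f : Fin B.len → Fin n, G (fun v => B.filterIdx fun i =>
        if h : i < B.len then decide ((f ⟨i, h⟩ : ℕ) = v) else false) =
      ((B.assigns n).map G).sum := by
  induction B using Branches.rec (motive_1 := fun _ => True) generalizing G with
  | node => trivial
  | nil =>
    simp only [Branches.assigns, Multiset.map_singleton, Multiset.sum_singleton,
      Branches.filterIdx]
    exact Fintype.sum_unique (ι := Fin 0 → Fin n) _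
  | cons s t B _ ih =>
    have key : ∀ (v₀ : Fin n) (f : Fin B.len → Fin n),
        (fun v => (Branches.cons s t B).filterIdx fun i =>
          if h : i < (Branches.cons s t B).len then
            decide (((Fin.cons v₀ f : Fin (B.len + 1) → Fin n) ⟨i, h⟩ : ℕ) = v) else false) =
        (fun φ => Function.update φ (v₀ : ℕ) (.cons s t (φ v₀))) (fun v => B.filterIdx fun i =>
          if h : i < B.len then decide ((f ⟨i, h⟩ : ℕ) = v) else false) := by
      intro v₀ f
      funext v
      have e : ∀ i, (if h : i + 1 < (Branches.cons s t B).len then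
            decide (((Fin.cons v₀ f : Fin (B.len + 1) → Fin n) ⟨i + 1, h⟩ : ℕ) = v) else false) =
          if h : i < B.len then decide ((f ⟨i, h⟩ : ℕ) = v) else false := by
        intro i
        by_cases h : i < B.len
        · have h' : i + 1 < (Branches.cons s t B).len := Nat.succ_lt_succ h
          rw [dif_pos h, dif_pos h']
          rfl
        · have h' : ¬ i + 1 < (Branches.cons s t B).len := fun h' => h (Nat.lt_of_succ_lt_succ h')
          rw [dif_neg h, dif_neg h']
      have e₀ : (if h : 0 < (Branches.cons s t B).len then
            decide (((Fin.cons v₀ f : Fin (B.len + 1) → Fin n) ⟨0, h⟩ : ℕ) = v) else false) =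
          decide ((v₀ : ℕ) = v) := dif_pos (Nat.succ_pos _)
      simp only [Branches.filterIdx, e, e₀, Function.update_apply, decide_eq_true_eq]
      by_cases h : (v₀ : ℕ) = v
      · subst h; simp
      · simp [h, Ne.symm h]
    have h := ih fun φ => ∑ v₀ : Fin n, G (Function.update φ (v₀ : ℕ) (.cons s t (φ v₀)))
    rw [Finset.sum_comm] at h
    refine ((Fin.consEquiv fun _ : Fin (B.len + 1) => Fin n).sum_comp _).symm.trans ?_
    rw [Fintype.sum_prod_type]
    refine Eq.trans ?_ (h.trans ?_)
    · exact Finset.sum_congr rfl fun v₀ _ => Finset.sum_congr rfl fun f _ =>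
        congrArg G (key v₀ f)
    · simp only [Branches.assigns, Multiset.map_bind, Multiset.map_singleton, Multiset.sum_bind,
        Multiset.sum_singleton]
      refine congrArg _ (Multiset.map_congr rfl fun φ _ => ?_)
      exact Fin.sum_univ_eq_sum_range (fun v => G (Function.update φ v (.cons s t (φ v)))) n

/-- The formal sum of a multiset of trees. -/
noncomputable def formalSum (m : Multiset (PTree S)) : PTree S →₀ ℚ :=
  (m.map fun T => Finsupp.single T 1).sum

theorem treeProd1_eq_formalSum (T₁ T₂ : PTree S) :
    treeProd1 T₁ T₂ = formalSum (T₂.grafts T₁.branches) := by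
  have h : T₂.grafts T₁.branches =
      (T₁.branches.assigns T₂.nv).bind fun φ => {T₂.graft φ} := by
    rw [PTree.nv, ← PTree.grafts_bind T₂ _ fun T => {T}, Multiset.bind_singleton,
      Multiset.map_id']
  cases T₁ with
  | node B =>
    rw [h, formalSum, Multiset.bind_singleton, Multiset.map_map]
    exact B.sum_filterIdx T₂.nv fun φ => Finsupp.single (T₂.graft φ) 1

theorem starLin_single_single (P : PTree S → PTree S → (PTree S →₀ ℚ)) (T₁ T₂ : PTree S) :
    starLin P (Finsupp.single T₁ 1) (Finsupp.single T₂ 1) = P T₁ T₂ := by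
  simp [starLin]

theorem starLin_formalSum_left (m : Multiset (PTree S)) (T : PTree S) :
    starLin treeProd1 (formalSum m) (Finsupp.single T 1) =
      formalSum (m.bind fun U => T.grafts U.branches) := by
  induction m using Multiset.induction_on with
  | empty => simp [formalSum]
  | cons U m ih =>
    simp only [formalSum, Multiset.map_cons, Multiset.sum_cons, Multiset.cons_bind,
      Multiset.map_add, Multiset.sum_add, map_add, LinearMap.add_apply] at ih ⊢
    rw [ih, starLin_single_single, treeProd1_eq_formalSum, formalSum]

theorem starLin_formalSum_right (m : Multiset (PTree S)) (T : PTree S) :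
    starLin treeProd1 (Finsupp.single T 1) (formalSum m) =
      formalSum (m.bind fun U => U.grafts T.branches) := by
  induction m using Multiset.induction_on with
  | empty => simp [formalSum]
  | cons U m ih =>
    simp only [formalSum, Multiset.map_cons, Multiset.sum_cons, Multiset.cons_bind,
      Multiset.map_add, Multiset.sum_add, map_add] at ih ⊢
    rw [ih, starLin_single_single, treeProd1_eq_formalSum, formalSum]

theorem PTree.grafts_assoc (A : Branches S) (T U : PTree S) :
    ((T.grafts A).bind fun V => U.grafts V.branches) =
      (U.grafts T.branches).bind fun V => V.grafts A := by
  cases T with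
  | node B =>
    cases U with
    | node C =>
      have h := congrArg (fun m => m.bind fun c => ({.node c} : Multiset (PTree S)))
        (Branches.glProd_assoc A B C)
      simp only [Multiset.bind_assoc] at h
      simpa only [Branches.node_grafts, Multiset.bind_assoc, Multiset.singleton_bind,
        PTree.branches] using h

theorem starLin_assoc_single (T₁ T₂ T₃ : PTree S) :
    starLin treeProd1 (starLin treeProd1 (Finsupp.single T₁ 1) (Finsupp.single T₂ 1))
        (Finsupp.single T₃ 1) =
      starLin treeProd1 (Finsupp.single T₁ 1)
        (starLin treeProd1 (Finsupp.single T₂ 1) (Finsupp.single T₃ 1)) := by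
  rw [starLin_single_single, starLin_single_single, treeProd1_eq_formalSum,
    treeProd1_eq_formalSum, starLin_formalSum_left, starLin_formalSum_right, PTree.grafts_assoc]

/-- The product `⋆₁` (the Grossman–Larson product) on `ℚRT(S)` is associative. -/
theorem star1_assoc (S : Type) (a b c : PTree S →₀ ℚ) :
    star1 (star1 a b) c = star1 a (star1 b c) := by
  simp only [star1]
  induction a using Finsupp.induction_linear with
  | zero => simp only [map_zero, LinearMap.zero_apply]
  | add a a' h h' => simp only [map_add, LinearMap.add_apply, h, h']
  | single T₁ q =>
    induction b using Finsupp.induction_linear with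
    | zero => simp only [map_zero, LinearMap.zero_apply]
    | add b b' h h' => simp only [map_add, LinearMap.add_apply, h, h']
    | single T₂ r =>
      induction c using Finsupp.induction_linear with
      | zero => simp only [map_zero]
      | add c c' h h' => simp only [map_add, h, h']
      | single T₃ u =>
        rw [← Finsupp.smul_single_one T₁, ← Finsupp.smul_single_one T₂,
          ← Finsupp.smul_single_one T₃]
        simp only [map_smul, LinearMap.smul_apply, starLin_assoc_single]
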